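/- arXiv:2411.10062 — 2 statements merged into one kernel-verified Lean document; each statement's English description precedes it below -/
import Mathlib

section
/- Let n ∈ ℕ, let c ∈ ℕ with c ≥ 1, and let x ∈ ℝ^n be a binary vector (each x_i ∈ {0,1}). Define π^sup_c(x) := 1 + Σ_{k=c}^{n} (−1)^{k−c+1} · C(k−1,c−1) · e_k(x). Then π^sup_c(x) = 0 if Σ_{i=1}^n x_i ≥ c, and π^sup_c(x) = 1 otherwise. Hence π^sup_c is a penalty function for the inequality constraint Σ_{i=1}^n x_i ≥ c taking only the values 0 and 1. -/
/-- Binomial orthogonality: the alternating sum of `C(m, d+j) C(d+j, d)` vanishes unless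
`m = d`. -/
lemma sum_neg_one_pow_mul_choose_mul_choose (d N m : ℕ) (h : m < d + N) :
    ∑ j ∈ Finset.range N, (-1 : ℤ) ^ j * ((d + j).choose d : ℤ) * (m.choose (d + j) : ℤ) =
      if m = d then 1 else 0 := by
  rcases lt_or_ge m d with hmd | hmd
  · rw [if_neg hmd.ne]
    refine Finset.sum_eq_zero fun j _ => ?_
    rw [Nat.choose_eq_zero_of_lt (show m < d + j by omega)]
    simp
  · obtain ⟨r, rfl⟩ := Nat.exists_eq_add_of_le hmd
    have hterm : ∀ j ∈ Finset.range N,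
        (-1 : ℤ) ^ j * ((d + j).choose d : ℤ) * ((d + r).choose (d + j) : ℤ) =
          ((d + r).choose d : ℤ) * ((-1) ^ j * (r.choose j : ℤ)) := by
      intro j _
      have key : (d + r).choose (d + j) * (d + j).choose d = (d + r).choose d * r.choose j := by
        rw [Nat.choose_mul (Nat.le_add_right d j)]
        simp
      have key' : ((d + r).choose (d + j) : ℤ) * ((d + j).choose d : ℤ) =
          ((d + r).choose d : ℤ) * (r.choose j : ℤ) := mod_cast key
      linear_combination (-1 : ℤ) ^ j * key'
    have hsub : ∑ j ∈ Finset.range (r + 1), (-1 : ℤ) ^ j * (r.choose j : ℤ) =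
        ∑ j ∈ Finset.range N, (-1 : ℤ) ^ j * (r.choose j : ℤ) := by
      refine Finset.sum_subset (Finset.range_subset_range.2 (by omega)) fun j _ hj => ?_
      rw [Finset.mem_range, not_lt] at hj
      rw [Nat.choose_eq_zero_of_lt (show r < j by omega)]
      simp
    rw [Finset.sum_congr rfl hterm, ← Finset.mul_sum, ← hsub, Int.alternating_sum_range_choose]
    by_cases hr : r = 0 <;> simp [hr]

/-- The alternating sum of `C(d+j, d) C(m, d+1+j)` is the indicator of `d < m`. -/
lemma sum_neg_one_pow_mul_choose_mul_choose_succ (d N m : ℕ) (h : m ≤ d + N) :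
    ∑ j ∈ Finset.range N, (-1 : ℤ) ^ j * ((d + j).choose d : ℤ) * (m.choose (d + j + 1) : ℤ) =
      if d < m then 1 else 0 := by
  induction m with
  | zero => simp
  | succ m ih =>
    simp only [Nat.choose_succ_succ', Nat.cast_add, mul_add, Finset.sum_add_distrib]
    rw [ih (by omega), sum_neg_one_pow_mul_choose_mul_choose d N m (by omega)]
    split_ifs <;> first | rfl | omega

/-- On a binary vector, the `k`-th elementary symmetric polynomial counts the `k`-subsets of the
support. -/
lemma sum_powersetCard_prod_of_binary {ι R : Type*} [Fintype ι] [CommSemiring R]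
    [DecidableEq R] (x : ι → R) (hx : ∀ i, x i = 0 ∨ x i = 1) (k : ℕ) :
    ∑ S ∈ Finset.univ.powersetCard k, ∏ i ∈ S, x i =
      (((Finset.univ.filter fun i => x i = 1).card.choose k : ℕ) : R) := by
  rw [← Finset.card_powersetCard, Finset.card_eq_sum_ones, Nat.cast_sum, Nat.cast_one]
  symm
  calc _ = ∑ S ∈ (Finset.univ.filter fun i => x i = 1).powersetCard k, ∏ i ∈ S, x i := by
        refine Finset.sum_congr rfl fun S hS => (Finset.prod_eq_one fun i hi => ?_).symm
        exact (Finset.mem_filter.1 ((Finset.mem_powersetCard.1 hS).1 hi)).2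
    _ = _ := by
        refine Finset.sum_subset (Finset.powersetCard_mono (Finset.filter_subset _ _))
          fun S hS hS' => ?_
        rw [Finset.mem_powersetCard] at hS hS'
        obtain ⟨i, hi, hi'⟩ := Finset.not_subset.1 fun hsub => hS' ⟨hsub, hS.2⟩
        refine Finset.prod_eq_zero hi ((hx i).resolve_right fun h1 => hi' ?_)
        simpa using h1


/-- Binary-valued penalty for the inequality constraint `∑ x_i ≥ c` (with `c ≥ 1`):
`π^sup_c(x) = 1 + ∑_{k=c}^n (-1)^{k-c+1} C(k-1,c-1) e_k(x)` equals `0` when the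
constraint holds and `1` otherwise, on binary vectors. -/
theorem stmt_7 (n c : ℕ) (hc : 1 ≤ c) (x : Fin n → ℝ)
    (hx : ∀ i, x i = 0 ∨ x i = 1) :
    ((c : ℝ) ≤ (∑ i, x i) →
      1 + ∑ k ∈ Finset.Icc c n, (-1 : ℝ) ^ (k - c + 1) * ((k - 1).choose (c - 1) : ℝ) *
        ∑ S ∈ Finset.univ.powersetCard k, ∏ i ∈ S, x i = 0) ∧
    (¬ (c : ℝ) ≤ (∑ i, x i) →
      1 + ∑ k ∈ Finset.Icc c n, (-1 : ℝ) ^ (k - c + 1) * ((k - 1).choose (c - 1) : ℝ) *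
        ∑ S ∈ Finset.univ.powersetCard k, ∏ i ∈ S, x i = 1) := by
  classical
  obtain ⟨d, rfl⟩ := Nat.exists_eq_add_of_le' hc
  set m := (Finset.univ.filter fun i => x i = 1).card with hm
  have hmn : m ≤ n := (Finset.card_le_univ _).trans_eq (Fintype.card_fin n)
  have hsum : ∑ i, x i = (m : ℝ) := by
    rw [hm, Finset.card_filter, Nat.cast_sum]
    refine Finset.sum_congr rfl fun i _ => ?_
    rcases hx i with h | h <;> simp [h]
  have hpen : ∑ k ∈ Finset.Icc (d + 1) n, (-1 : ℝ) ^ (k - (d + 1) + 1) *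
      ((k - 1).choose (d + 1 - 1) : ℝ) * ∑ S ∈ Finset.univ.powersetCard k, ∏ i ∈ S, x i =
        -(if d < m then 1 else 0) := by
    have key := congrArg (Int.cast : ℤ → ℝ)
      (sum_neg_one_pow_mul_choose_mul_choose_succ d (n - d) m (by omega))
    push_cast at key
    rw [← key, ← Finset.Ico_add_one_right_eq_Icc, Finset.sum_Ico_eq_sum_range,
      ← Finset.sum_neg_distrib]
    refine Finset.sum_congr (by congr 1; omega) fun j _ => ?_
    rw [sum_powersetCard_prod_of_binary x hx, ← hm, show d + 1 + j - (d + 1) + 1 = j + 1 by omega,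
      show d + 1 + j - 1 = d + j by omega, show d + 1 - 1 = d by omega,
      show d + 1 + j = d + j + 1 by omega]
    ring
  rw [hpen, hsum, Nat.cast_le, Nat.succ_le_iff]
  constructor <;> intro h <;> simp [h]
end

section
/- Consider the Extended Bin Packing problem with n trains and m groups: an acceptance relation A ⊆ [n]×[m] (with (i,j) ∈ A iff group g_j accepts train T_i), costs c_i ∈ ℝ, benefits p_i ∈ ℝ, capacity CMax ∈ ℕ, binary variables x ∈ {0,1}^n and y = (y_ij)_{(i,j)∈A} ∈ {0,1}^A, and nominal objective f(x,y) := Σ_{i=1}^n c_i·x_i − Σ_{(i,j)∈A} p_i·y_ij. Let penUni_j(y) := Σ_{k=2}^{|G_j|} (−1)^k (k−1) Σ_{I⊆G_j, |I|=k} Π_{i∈I} y_ij with G_j := {i : (i,j) ∈ A}, and penCapa_i(x,y) := (1−x_i)·pen_0 + x_i·pen_1 with pen_0 := Σ_{k=1}^{|H_i|} (−1)^{k+1} Σ_{J⊆H_i,|J|=k} Π_{j∈J} y_ij, pen_1 := Σ_{k=CMax+1}^{|H_i|} (−1)^{k−CMax+1} C(k−1,CMax) Σ_{J⊆H_i,|J|=k}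 Π_{j∈J} y_ij, and H_i := {j : (i,j) ∈ A}. Then for every binary (x,y), the PUBO loss f(x,y) + Σ_{j=1}^m λ_{u,j}·penUni_j(y) + Σ_{i=1}^n λ_{c,i}·penCapa_i(x,y) equals f(x,y) + Σ_{j=1}^m λ_{u,j}·[Σ_{i∈G_j} y_ij > 1] + Σ_{i=1}^n λ_{c,i}·[Σ_{j∈H_i} y_ij > CMax·x_i], where [P] denotes the indicator (1 if P holds, 0 otherwise). -/
/-- Truncated alternating binomial sum detecting `c < s`. -/
lemma sum_range_alternating_choose_mul_choose (c s M : ℕ) (hM : s ≤ c + M) :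
    ∑ l ∈ Finset.range M, (-1 : ℝ) ^ l * ((c + l).choose c : ℝ) * (s.choose (c + 1 + l) : ℝ)
      = if c < s then 1 else 0 := by
  induction s with
  | zero =>
    simp only [Nat.not_lt_zero, if_false]
    refine Finset.sum_eq_zero fun l _ => ?_
    rw [Nat.choose_eq_zero_of_lt (by omega : 0 < c + 1 + l)]
    simp
  | succ s ih =>
    have pascal : ∀ l, ((s + 1).choose (c + 1 + l) : ℝ)
        = (s.choose (c + l) : ℝ) + (s.choose (c + 1 + l) : ℝ) := by
      intro l
      rw [show c + 1 + l = (c + l) + 1 by omega, Nat.choose_succ_succ]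
      push_cast
      rfl
    simp only [pascal, mul_add, Finset.sum_add_distrib]
    rw [ih (by omega)]
    rcases lt_or_ge s c with hsc | hcs
    · rw [Finset.sum_eq_zero, if_neg (by omega), if_neg (by omega), add_zero]
      intro l _
      rw [Nat.choose_eq_zero_of_lt (by omega : s < c + l)]
      simp
    · have hterm : ∀ l, (-1 : ℝ) ^ l * ((c + l).choose c : ℝ) * (s.choose (c + l) : ℝ)
          = (s.choose c : ℝ) * ((-1 : ℝ) ^ l * ((s - c).choose l : ℝ)) := by
        intro l
        have h := Nat.choose_mul (n := s) (k := c + l) (s := c) (by omega)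
        rw [Nat.add_sub_cancel_left] at h
        have h' : (s.choose (c + l) : ℝ) * ((c + l).choose c : ℝ)
            = (s.choose c : ℝ) * ((s - c).choose l : ℝ) := by exact_mod_cast h
        linear_combination (-1 : ℝ) ^ l * h'
      have halt : ∑ l ∈ Finset.range M, (-1 : ℝ) ^ l * ((s - c).choose l : ℝ)
          = if s - c = 0 then 1 else 0 := by
        rw [← Finset.sum_subset (Finset.range_mono (by omega : s - c + 1 ≤ M))]
        · exact_mod_cast Int.alternating_sum_range_choose (n := s - c)
        · intro l _ hl
          rw [Finset.mem_range, not_lt] at hl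
          rw [Nat.choose_eq_zero_of_lt (by omega)]
          simp
      simp only [hterm]
      rw [← Finset.mul_sum, halt]
      rcases hcs.eq_or_lt with rfl | hlt
      · simp
      · rw [if_neg (by omega), if_pos hlt, if_pos (by omega)]
        simp

/-- The elementary symmetric sums of a binary family are binomial coefficients. -/
lemma sum_powersetCard_prod_of_binary_s17 {ι : Type*} (S : Finset ι) (z : ι → ℝ)
    (hz : ∀ i ∈ S, z i = 0 ∨ z i = 1) (k : ℕ) :
    ∑ J ∈ S.powersetCard k, ∏ j ∈ J, z j = ((S.filter (fun i => z i = 1)).card.choose k : ℝ) := by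
  rw [← Finset.card_powersetCard, Finset.cast_card]
  symm
  rw [← Finset.sum_subset (Finset.powersetCard_mono (Finset.filter_subset (fun i => z i = 1) S))]
  · refine Finset.sum_congr rfl fun J hJ => (Finset.prod_eq_one fun j hj => ?_).symm
    exact (Finset.mem_filter.1 ((Finset.mem_powersetCard.1 hJ).1 hj)).2
  · intro J hJ hJT
    rw [Finset.mem_powersetCard] at hJ hJT
    obtain ⟨j, hj, hjT⟩ := Finset.not_subset.1 fun h => hJT ⟨h, hJ.2⟩
    refine Finset.prod_eq_zero hj ((hz j (hJ.1 hj)).resolve_right fun h => hjT ?_)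
    exact Finset.mem_filter.2 ⟨hJ.1 hj, h⟩

/-- The penalty polynomial of the cardinality constraint `∑ z ≤ c` is its violation indicator
on binary points. -/
lemma cardinality_penalty_eq_indicator {ι : Type*} (S : Finset ι) (z : ι → ℝ)
    (hz : ∀ i ∈ S, z i = 0 ∨ z i = 1) (c : ℕ) :
    ∑ k ∈ Finset.Icc (c + 1) S.card, (-1 : ℝ) ^ (k - c + 1) * ((k - 1).choose c : ℝ) *
        ∑ J ∈ S.powersetCard k, ∏ j ∈ J, z j
      = if (c : ℝ) < ∑ i ∈ S, z i then 1 else 0 := by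
  have hsum : ∑ i ∈ S, z i = ((S.filter (fun i => z i = 1)).card : ℝ) := by
    rw [Finset.cast_card, Finset.sum_filter]
    refine Finset.sum_congr rfl fun i hi => ?_
    rcases hz i hi with h | h <;> simp [h]
  have hcard := Finset.card_filter_le S (fun i => z i = 1)
  simp only [sum_powersetCard_prod_of_binary_s17 S z hz, hsum, Nat.cast_lt]
  rw [← sum_range_alternating_choose_mul_choose c _ (S.card - c) (by omega),
    ← Finset.Ico_add_one_right_eq_Icc, Finset.sum_Ico_eq_sum_range,
    show S.card + 1 - (c + 1) = S.card - c by omega]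
  refine Finset.sum_congr rfl fun l _ => ?_
  rw [show c + 1 + l - c + 1 = l + 2 by omega, show c + 1 + l - 1 = c + l by omega, pow_add]
  norm_num

/-- PUBO reformulation of the Extended Bin Packing problem: on binary variables, the
PUBO loss (nominal objective plus the binary-valued penalty polynomials `penUni_j` and
`penCapa_i`) equals the nominal objective plus the penalty coefficients times the
indicators of violation of the constraints (Uni_j) and (Capa_i). -/
theorem stmt_17 (n m : ℕ) (A : Finset (Fin n × Fin m))
    (c p : Fin n → ℝ) (CMax : ℕ)
    (lamu : Fin m → ℝ) (lamc : Fin n → ℝ)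
    (hlamu : ∀ j, 0 < lamu j) (hlamc : ∀ i, 0 < lamc i)
    (x : Fin n → ℝ) (hx : ∀ i, x i = 0 ∨ x i = 1)
    (y : Fin n × Fin m → ℝ) (hy : ∀ ij ∈ A, y ij = 0 ∨ y ij = 1) :
    ((∑ i, c i * x i) - ∑ ij ∈ A, p ij.1 * y ij)
      + (∑ j, lamu j *
          ∑ k ∈ Finset.Icc 2 (Finset.univ.filter (fun i : Fin n => (i, j) ∈ A)).card,
            (-1 : ℝ) ^ k * ((k - 1 : ℕ) : ℝ) *
              ∑ I ∈ (Finset.univ.filter (fun i : Fin n => (i, j) ∈ A)).powersetCard k,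
                ∏ i ∈ I, y (i, j))
      + (∑ i, lamc i *
          ((1 - x i) *
            (∑ k ∈ Finset.Icc 1 (Finset.univ.filter (fun j : Fin m => (i, j) ∈ A)).card,
              (-1 : ℝ) ^ (k + 1) *
                ∑ J ∈ (Finset.univ.filter (fun j : Fin m => (i, j) ∈ A)).powersetCard k,
                  ∏ j ∈ J, y (i, j))
          + x i *
            (∑ k ∈ Finset.Icc (CMax + 1)
                (Finset.univ.filter (fun j : Fin m => (i, j) ∈ A)).card,
              (-1 : ℝ) ^ (k - CMax + 1) * ((k - 1).choose CMax : ℝ) *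
                ∑ J ∈ (Finset.univ.filter (fun j : Fin m => (i, j) ∈ A)).powersetCard k,
                  ∏ j ∈ J, y (i, j))))
    = ((∑ i, c i * x i) - ∑ ij ∈ A, p ij.1 * y ij)
      + (∑ j, lamu j *
          (if 1 < ∑ i ∈ Finset.univ.filter (fun i : Fin n => (i, j) ∈ A), y (i, j)
            then 1 else 0))
      + (∑ i, lamc i *
          (if (CMax : ℝ) * x i
              < ∑ j ∈ Finset.univ.filter (fun j : Fin m => (i, j) ∈ A), y (i, j)
            then 1 else 0)) := by
  have hG : ∀ j, ∀ i ∈ Finset.univ.filter (fun i : Fin n => (i, j) ∈ A),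
      y (i, j) = 0 ∨ y (i, j) = 1 := fun j i hi => hy _ (Finset.mem_filter.1 hi).2
  have hH : ∀ i, ∀ j ∈ Finset.univ.filter (fun j : Fin m => (i, j) ∈ A),
      y (i, j) = 0 ∨ y (i, j) = 1 := fun i j hj => hy _ (Finset.mem_filter.1 hj).2
  congr 1
  · congr 1
    refine Finset.sum_congr rfl fun j _ => congrArg (lamu j * ·) ?_
    have h := cardinality_penalty_eq_indicator _ (fun i => y (i, j)) (hG j) 1
    rw [Nat.cast_one] at h
    rw [← h]
    refine Finset.sum_congr rfl fun k hk => ?_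
    rw [Nat.sub_add_cancel (by have := (Finset.mem_Icc.1 hk).1; omega), Nat.choose_one_right]
  · refine Finset.sum_congr rfl fun i _ => congrArg (lamc i * ·) ?_
    rcases hx i with h0 | h1
    · have h := cardinality_penalty_eq_indicator _ (fun j => y (i, j)) (hH i) 0
      simp only [Nat.cast_zero, Nat.choose_zero_right, Nat.cast_one, mul_one, Nat.sub_zero,
        zero_add] at h
      rw [h0, sub_zero, one_mul, zero_mul, add_zero, mul_zero, h]
    · rw [h1, sub_self, zero_mul, zero_add, one_mul, mul_one]
      exact cardinality_penalty_eq_indicator _ (fun j => y (i, j)) (hH i) CMax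
end
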